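/- arXiv:0805.0762 — 2 statements merged into one kernel-verified Lean document; each statement's English description precedes it below -/
import Mathlib

section
/- Let Ā be a unital dendriform algebra and a, b ∈ A. Let Z ∈ Ā[[λ]] be the solution of Z = 1 + λ Z ≻ b with inverse Z⁻¹ (solving Z⁻¹ = 1 − λ b ≺ Z⁻¹). Then X := Z⁻¹ * (Z ≻ a ≺ Z⁻¹) * Z solves the left pre-Lie equation X = a + λ X ▷ b in Ā[[λ]], where x ▷ y := x ≻ y − y ≺ x. -/
open Finset

section DendriformAug

variable {k : Type} [Field k] [CharZero k]
variable {D : Type} [AddCommGroup D] [Module k D]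

/-- Elements of `Ā[[λ]]`, the power series over the augmentation `Ā = k·1 ⊕ D` of a
dendriform algebra `D` by a unit `1`, represented as a pair consisting of the
scalar-part series and the `D`-part series. -/
abbrev Aug (k D : Type) : Type := (ℕ → k) × (ℕ → D)

/-- The unit `1` of `Ā[[λ]]`. -/
def augOne : Aug k D := (fun n => if n = 0 then 1 else 0, 0)

/-- The embedding of `D` into `Ā[[λ]]` as constant series. -/
def ofD (a : D) : Aug k D := (0, fun n => if n = 0 then a else 0)

/-- Multiplication by the formal parameter `λ` on `Ā[[λ]]`. -/
def lam (x : Aug k D) : Aug k D :=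
  (fun n => match n with | 0 => 0 | Nat.succ m => x.1 m,
   fun n => match n with | 0 => 0 | Nat.succ m => x.2 m)

variable (p s : D →ₗ[k] D →ₗ[k] D)

/-- Cauchy convolution of two `D`-valued series along a bilinear operation on `D`. -/
def conv (b : D →ₗ[k] D →ₗ[k] D) (f g : ℕ → D) : ℕ → D :=
  fun n => ∑ ij ∈ antidiagonal n, b (f ij.1) (g ij.2)

/-- Cauchy convolution of a scalar series with a `D`-valued series. -/
def sconv (t : ℕ → k) (f : ℕ → D) : ℕ → D :=
  fun n => ∑ ij ∈ antidiagonal n, t ij.1 • f ij.2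

/-- Cauchy convolution of two scalar series. -/
def kconv (u t : ℕ → k) : ℕ → k :=
  fun n => ∑ ij ∈ antidiagonal n, u ij.1 * t ij.2

/-- The left dendriform product `≺` on `Ā[[λ]]`, extending `p : D → D → D`
λ-adically, with `1 ≺ a = 0` and `a ≺ 1 = a` for `a ∈ D[[λ]]`
(`1 ≺ 1` being left undefined, no scalar part is produced). -/
def precA (x y : Aug k D) : Aug k D :=
  (0, conv p x.2 y.2 + sconv y.1 x.2)

/-- The right dendriform product `≻` on `Ā[[λ]]`, extending `s : D → D → D`
λ-adically, with `1 ≻ a = a` and `a ≻ 1 = 0` for `a ∈ D[[λ]]`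
(`1 ≻ 1` being left undefined, no scalar part is produced). -/
def succA (x y : Aug k D) : Aug k D :=
  (0, conv s x.2 y.2 + sconv x.1 y.2)

/-- The associative product `x * y = x ≺ y + x ≻ y` on `Ā[[λ]]`, for which the
unit satisfies `a * 1 = 1 * a = a` and `1 * 1 = 1`. -/
def starA (x y : Aug k D) : Aug k D :=
  (kconv x.1 y.1,
   conv p x.2 y.2 + conv s x.2 y.2 + sconv y.1 x.2 + sconv x.1 y.2)

section

omit [CharZero k]

/-- The series in `k × D` underlying an element of `Ā[[λ]]`. -/
def augSeries (x : Aug k D) : ℕ → k × D := fun n => (x.1 n, x.2 n)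

omit [Field k] [AddCommGroup D] [Module k D] in
theorem augSeries_injective : Function.Injective (augSeries : Aug k D → ℕ → k × D) := by
  intro x y h
  refine Prod.ext (funext fun n => ?_) (funext fun n => ?_)
  · exact congrArg Prod.fst (congrFun h n)
  · exact congrArg Prod.snd (congrFun h n)

/-- The operation `≺` on the augmentation `k × D`. -/
def precUnit : (k × D) →ₗ[k] (k × D) →ₗ[k] (k × D) :=
  LinearMap.mk₂ k (fun x y => (0, p x.2 y.2 + y.1 • x.2))
    (fun _ _ _ => by ext <;> simp; abel)
    (fun c x y => by ext <;> simp [smul_comm _ c])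
    (fun _ _ _ => by ext <;> simp [add_smul]; abel)
    (fun _ _ _ => by ext <;> simp [mul_smul])

/-- The operation `≻` on the augmentation `k × D`. -/
def succUnit : (k × D) →ₗ[k] (k × D) →ₗ[k] (k × D) :=
  LinearMap.mk₂ k (fun x y => (0, s x.2 y.2 + x.1 • y.2))
    (fun _ _ _ => by ext <;> simp [add_smul]; abel)
    (fun _ _ _ => by ext <;> simp [mul_smul])
    (fun _ _ _ => by ext <;> simp; abel)
    (fun c x y => by ext <;> simp [smul_comm _ c])

/-- The associative product on the augmentation `k × D`. -/
def starUnit : (k × D) →ₗ[k] (k × D) →ₗ[k] (k × D) :=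
  LinearMap.mk₂ k (fun x y => (x.1 * y.1, p x.2 y.2 + s x.2 y.2 + y.1 • x.2 + x.1 • y.2))
    (fun _ _ _ => by ext <;> simp [add_smul, add_mul]; abel)
    (fun c x y => by ext <;> simp [mul_smul, mul_assoc, smul_comm _ c])
    (fun _ _ _ => by ext <;> simp [add_smul, mul_add]; abel)
    (fun c x y => by ext <;> simp [mul_smul, mul_left_comm, smul_comm _ c])

theorem augSeries_precA (x y : Aug k D) :
    augSeries (precA p x y) = conv (precUnit p) (augSeries x) (augSeries y) := by
  funext n
  ext <;> simp [augSeries, precA, precUnit, conv, sconv, Prod.fst_sum, Prod.snd_sum,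
    sum_add_distrib]
  exact Finset.Nat.sum_antidiagonal_swap (f := fun ij => y.1 ij.2 • x.2 ij.1)

theorem augSeries_succA (x y : Aug k D) :
    augSeries (succA s x y) = conv (succUnit s) (augSeries x) (augSeries y) := by
  funext n
  ext <;> simp [augSeries, succA, succUnit, conv, sconv, Prod.fst_sum, Prod.snd_sum,
    sum_add_distrib]

theorem augSeries_starA (x y : Aug k D) :
    augSeries (starA p s x y) = conv (starUnit p s) (augSeries x) (augSeries y) := by
  funext n
  ext <;> simp [augSeries, starA, starUnit, conv, sconv, kconv, Prod.fst_sum, Prod.snd_sum,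
    sum_add_distrib]
  exact Finset.Nat.sum_antidiagonal_swap (f := fun ij => y.1 ij.2 • x.2 ij.1)

theorem conv_conv {q r q' r' : D →ₗ[k] D →ₗ[k] D}
    (h : ∀ a b c, q (r a b) c = q' a (r' b c)) (f g e : ℕ → D) :
    conv q (conv r f g) e = conv q' f (conv r' g e) := by
  funext n
  simp only [conv, map_sum, LinearMap.sum_apply, h, sum_sigma']
  refine sum_nbij' (fun ⟨⟨_, j⟩, ⟨i, l⟩⟩ => ⟨(i, l + j), (l, j)⟩)
    (fun ⟨⟨i, _⟩, ⟨j, l⟩⟩ => ⟨(i + j, l), (i, j)⟩) ?_ ?_ ?_ ?_ ?_ <;>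
  · rintro ⟨⟨_, _⟩, ⟨_, _⟩⟩ h
    simp only [mem_sigma, HasAntidiagonal.mem_antidiagonal] at h ⊢ <;>
    grind

theorem starA_assoc
    (ax1 : ∀ a b c : D, p (p a b) c = p a (p b c + s b c))
    (ax2 : ∀ a b c : D, p (s a b) c = s a (p b c))
    (ax3 : ∀ a b c : D, s a (s b c) = s (p a b + s a b) c) (x y z : Aug k D) :
    starA p s (starA p s x y) z = starA p s x (starA p s y z) := by
  apply augSeries_injective
  simp only [augSeries_starA]
  refine conv_conv (fun a b c => ?_) _ _ _
  have h3 := ax3 a.2 b.2 c.2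
  simp only [map_add, LinearMap.add_apply] at ax1 h3
  ext <;> simp [starUnit, ax1, ax2, h3, mul_assoc, mul_smul, smul_add]
  rw [smul_comm c.1 a.1, smul_comm c.1 b.1]
  abel

theorem starA_succA
    (ax3 : ∀ a b c : D, s a (s b c) = s (p a b + s a b) c) (x y z : Aug k D) :
    succA s (starA p s x y) z = succA s x (succA s y z) := by
  apply augSeries_injective
  simp only [augSeries_starA, augSeries_succA]
  refine conv_conv (fun a b c => ?_) _ _ _
  ext <;> simp [starUnit, succUnit, ax3, mul_smul, smul_add]
  abel

theorem precA_precA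
    (ax1 : ∀ a b c : D, p (p a b) c = p a (p b c + s b c)) (x y z : Aug k D) :
    precA p (precA p x y) z = precA p x (starA p s y z) := by
  apply augSeries_injective
  simp only [augSeries_starA, augSeries_precA]
  refine conv_conv (fun a b c => ?_) _ _ _
  ext <;> simp [starUnit, precUnit, ax1, mul_smul, smul_add]
  rw [smul_comm c.1 b.1]
  abel

theorem precA_succA (ax2 : ∀ a b c : D, p (s a b) c = s a (p b c)) (x y z : Aug k D) :
    precA p (succA s x y) z = succA s x (precA p y z) := by
  apply augSeries_injective
  simp only [augSeries_succA, augSeries_precA]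
  refine conv_conv (fun a b c => ?_) _ _ _
  ext <;> simp [succUnit, precUnit, ax2, smul_add]
  rw [smul_comm c.1 a.1]
  abel

section

omit [Module k D]

theorem augSeries_add (x y : Aug k D) : augSeries (x + y) = augSeries x + augSeries y := rfl

theorem augSeries_sub (x y : Aug k D) : augSeries (x - y) = augSeries x - augSeries y := rfl

theorem augSeries_lam_zero (x : Aug k D) : augSeries (lam x) 0 = 0 := rfl

theorem augSeries_lam_succ (x : Aug k D) (n : ℕ) :
    augSeries (lam x) (n + 1) = augSeries x n := rfl

theorem augSeries_augOne_zero : augSeries (augOne : Aug k D) 0 = (1, 0) := rfl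

theorem augSeries_augOne_succ (n : ℕ) : augSeries (augOne : Aug k D) (n + 1) = 0 := rfl

theorem lam_sub (x y : Aug k D) : lam (x - y) = lam x - lam y := by
  apply augSeries_injective
  funext n
  cases n <;> simp [augSeries_sub, augSeries_lam_zero, augSeries_lam_succ]

end

theorem conv_add_left (q : D →ₗ[k] D →ₗ[k] D) (f g e : ℕ → D) :
    conv q (f + g) e = conv q f e + conv q g e := by
  funext n; simp [conv, sum_add_distrib]

theorem conv_add_right (q : D →ₗ[k] D →ₗ[k] D) (f g e : ℕ → D) :
    conv q f (g + e) = conv q f g + conv q f e := by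
  funext n; simp [conv, sum_add_distrib]

theorem succA_add_right (x y z : Aug k D) :
    succA s x (y + z) = succA s x y + succA s x z := by
  apply augSeries_injective
  simp only [augSeries_succA, augSeries_add, conv_add_right]

theorem precA_add_left (x y z : Aug k D) :
    precA p (x + y) z = precA p x z + precA p y z := by
  apply augSeries_injective
  simp only [augSeries_precA, augSeries_add, conv_add_left]

theorem succA_lam (x y : Aug k D) : succA s x (lam y) = lam (succA s x y) := by
  apply augSeries_injective
  funext n
  cases n with
  | zero => simp [augSeries_succA, conv, augSeries_lam_zero]
  | succ n =>
    simp [augSeries_succA, conv, augSeries_lam_zero, augSeries_lam_succ,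
      Nat.sum_antidiagonal_succ']

theorem precA_lam (x y : Aug k D) : precA p (lam x) y = lam (precA p x y) := by
  apply augSeries_injective
  funext n
  cases n with
  | zero => simp [augSeries_precA, conv, augSeries_lam_zero]
  | succ n =>
    simp [augSeries_precA, conv, augSeries_lam_zero, augSeries_lam_succ,
      Nat.sum_antidiagonal_succ]

theorem succA_one (x : Aug k D) : succA s x augOne = 0 := by
  apply augSeries_injective
  funext n
  cases n <;>
    simp [augSeries_succA, conv, augSeries_augOne_zero, augSeries_augOne_succ,
      Nat.sum_antidiagonal_succ', succUnit] <;> rfl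

theorem one_precA (x : Aug k D) : precA p augOne x = 0 := by
  apply augSeries_injective
  funext n
  cases n <;>
    simp [augSeries_precA, conv, augSeries_augOne_zero, augSeries_augOne_succ,
      Nat.sum_antidiagonal_succ, precUnit] <;> rfl

theorem one_succA (x : Aug k D) (hx : x.1 = 0) : succA s augOne x = x := by
  apply augSeries_injective
  funext n
  cases n <;>
    simp [augSeries_succA, conv, augSeries_augOne_zero, augSeries_augOne_succ,
      Nat.sum_antidiagonal_succ, succUnit] <;> simp [augSeries, hx]

theorem precA_one (x : Aug k D) (hx : x.1 = 0) : precA p x augOne = x := by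
  apply augSeries_injective
  funext n
  cases n <;>
    simp [augSeries_precA, conv, augSeries_augOne_zero, augSeries_augOne_succ,
      Nat.sum_antidiagonal_succ', precUnit] <;> simp [augSeries, hx]

theorem one_starA (x : Aug k D) : starA p s augOne x = x := by
  apply augSeries_injective
  funext n
  cases n <;>
    simp [augSeries_starA, conv, augSeries_augOne_zero, augSeries_augOne_succ,
      Nat.sum_antidiagonal_succ, starUnit]

theorem kconv_zero_left (t : ℕ → k) : kconv 0 t = 0 := by
  funext n; simp [kconv]

theorem kconv_zero_right (t : ℕ → k) : kconv t 0 = 0 := by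
  funext n; simp [kconv]

theorem starA_eq_precA_add_succA (x y : Aug k D) (h : x.1 = 0 ∨ y.1 = 0) :
    starA p s x y = precA p x y + succA s x y := by
  refine Prod.ext ?_ ?_
  · rcases h with h | h <;> simp [starA, precA, succA, h, kconv_zero_left, kconv_zero_right]
  · simp only [starA, precA, succA, Prod.snd_add]
    abel

end

/-- Let `Ā` be a unital dendriform algebra and `a b ∈ A`.  Let `Z` solve
`Z = 1 + λ Z ≻ b` with inverse `Z⁻¹` solving `Z⁻¹ = 1 − λ b ≺ Z⁻¹`.  Then
`X := Z⁻¹ * (Z ≻ a ≺ Z⁻¹) * Z` solves the left pre-Lie equation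
`X = a + λ X ▷ b`, where `x ▷ y := x ≻ y − y ≺ x`. -/
theorem dendriform_preLie_equation_solution
    (ax1 : ∀ a b c : D, p (p a b) c = p a (p b c + s b c))
    (ax2 : ∀ a b c : D, p (s a b) c = s a (p b c))
    (ax3 : ∀ a b c : D, s a (s b c) = s (p a b + s a b) c)
    (a b : D) (Z Zi X : Aug k D)
    (hZ : Z = augOne + lam (succA s Z (ofD b)))
    (hZi : Zi = augOne - lam (precA p (ofD b) Zi))
    (hZinv : starA p s Z Zi = augOne ∧ starA p s Zi Z = augOne)
    (hX : X = starA p s (starA p s Zi (precA p (succA s Z (ofD a)) Zi)) Z) :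
    X = ofD a + lam (succA s X (ofD b) - precA p (ofD b) X) := by
  have hassoc := starA_assoc p s ax1 ax2 ax3
  obtain ⟨hZZi, hZiZ⟩ := hZinv
  set W := precA p (succA s Z (ofD a)) Zi with hW
  have hX1 : X.1 = 0 := by
    rw [hX]
    change kconv (kconv Zi.1 W.1) Z.1 = 0
    rw [show W.1 = 0 from rfl, kconv_zero_right, kconv_zero_left]
  have hZX : starA p s Z X = starA p s W Z := by
    rw [hX, ← hassoc, ← hassoc, hZZi, one_starA]
  have hWZ : starA p s W Z
      = succA s Z (ofD a) + lam (succA s Z (succA s X (ofD b))) := by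
    have hprec : precA p W Z = succA s Z (ofD a) := by
      rw [hW, precA_precA p s ax1, hZiZ, precA_one _ _ rfl]
    have hsucc : succA s W Z = lam (succA s Z (succA s X (ofD b))) := by
      conv_lhs => rw [hZ]
      rw [succA_add_right, succA_one, zero_add, succA_lam, ← starA_succA p s ax3,
        ← starA_succA p s ax3, hZX]
    rw [starA_eq_precA_add_succA p s W Z (Or.inl rfl), hprec, hsucc]
  have hZX' : starA p s Z X = succA s Z X + lam (succA s Z (precA p (ofD b) X)) := by
    have hprec : precA p Z X = lam (succA s Z (precA p (ofD b) X)) := by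
      conv_lhs => rw [hZ]
      rw [precA_add_left, one_precA, zero_add, precA_lam, precA_succA p s ax2]
    rw [starA_eq_precA_add_succA p s Z X (Or.inr hX1), hprec, add_comm]
  have hcancel : ∀ x y : Aug k D, x.1 = 0 → y.1 = 0 →
      succA s Z x = succA s Z y → x = y := by
    intro x y hx hy h
    rw [← one_succA s x hx, ← one_succA s y hy, ← hZiZ, starA_succA p s ax3,
      starA_succA p s ax3, h]
  have key : X + lam (precA p (ofD b) X) = ofD a + lam (succA s X (ofD b)) := by
    have hlam : ∀ x : Aug k D, x.1 = 0 → (lam x).1 = 0 := by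
      intro x hx
      funext n
      cases n <;> simp [lam, hx]
    apply hcancel
    · rw [Prod.fst_add, hX1, hlam _ rfl, add_zero]
    · rw [Prod.fst_add, hlam _ rfl, add_zero]
      rfl
    · rw [succA_add_right, succA_add_right, succA_lam, succA_lam, ← hZX', hZX, hWZ]
  rw [lam_sub, add_sub, ← key, add_sub_cancel_right]

end DendriformAug
end

section
/- Pre-Lie Magnus expansion: let Ā be a unital dendriform algebra, a ∈ A, and let Y ∈ Ā[[λ]] be the solution of Y = 1 + λ a ≺ Y, whose inverse Y⁻¹ solves Y⁻¹ = 1 − λ Y⁻¹ ≻ a. Let Ω' = Ω'(λa) be the element of λĀ[[λ]] such that Y = exp*(Ω') and Y⁻¹ = exp*(−Ω'), where exp*(x) := Σ_{n≥0} x^{*n}/n!. Then Ω' satisfies the recursions Ω'(λa) = Σ_{m≥0} (−1)^m (B_m/m!) R_◁[Ω']^{(m)}(λa) and Ω'(λa) = Σ_{m≥0} (B_m/m!) L_▷[Ω']^{(m)}(λa), where B_m are the Bernoulli numbers, L_▷[x](y) := x ▷ y := x ≻ y − y ≺ x, and R_◁[x](y) := y ◁ x := y ≺ x − x ≻ y.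 -/
open Finset

section DendriformAug

variable {k : Type} [Field k] [CharZero k]
variable {D : Type} [AddCommGroup D] [Module k D]

variable (p s : D →ₗ[k] D →ₗ[k] D)

/-- The left pre-Lie product `x ▷ y := x ≻ y − y ≺ x` on `Ā[[λ]]`. -/
def preLieL (x y : Aug k D) : Aug k D := succA s x y - precA p y x

/-- The right pre-Lie product `x ◁ y := x ≺ y − y ≻ x` on `Ā[[λ]]`. -/
def preLieR (x y : Aug k D) : Aug k D := precA p x y - succA s y x

/-- Iteration `L_▷[x]^{(m)}(y)` of the operator `L_▷[x] : y ↦ x ▷ y`. -/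
def iterL (x : Aug k D) : ℕ → Aug k D → Aug k D
  | 0, y => y
  | m + 1, y => preLieL p s x (iterL x m y)

/-- Iteration `R_◁[x]^{(m)}(y)` of the operator `R_◁[x] : y ↦ y ◁ x`. -/
def iterR (x : Aug k D) : ℕ → Aug k D → Aug k D
  | 0, y => y
  | m + 1, y => preLieR p s (iterR x m y) x

/-- `*`-powers `x^{*n}` in `Ā[[λ]]`. -/
def starPow (x : Aug k D) : ℕ → Aug k D
  | 0 => augOne
  | n + 1 => starA p s (starPow x n) x

/-- The λ-adic sum `Σ_{m ≥ 0} F m` of a family whose `m`-th term has λ-adic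
valuation at least `m`:  the coefficient of `λ^n` is `Σ_{m ≤ n} (F m)_n`. -/
def seriesSum (F : ℕ → Aug k D) : Aug k D :=
  (fun n => ∑ m ∈ range (n + 1), (F m).1 n,
   fun n => ∑ m ∈ range (n + 1), (F m).2 n)

/-- The exponential `exp*(x) := Σ_{n ≥ 0} x^{*n}/n!` for `x ∈ λ Ā[[λ]]`. -/
def expStar (x : Aug k D) : Aug k D :=
  seriesSum (fun m => ((Nat.factorial m : k))⁻¹ • starPow p s x m)

end DendriformAug

section DendriformSeries

variable {k : Type} [Field k]
variable {D : Type} [AddCommGroup D] [Module k D]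

/-- The series in `D[[λ]]` of `λ`-adic valuation at least `m`. -/
def vanishBelow (k D : Type) [Field k] [AddCommGroup D] [Module k D] (m : ℕ) :
    Submodule k (ℕ → D) where
  carrier := {x | ∀ i < m, x i = 0}
  add_mem' hx hy i hi := by simp [hx i hi, hy i hi]
  zero_mem' _ _ := rfl
  smul_mem' c x hx i hi := by simp [hx i hi]

/-- The `λ`-adic sum of a family of `D`-valued series whose `m`-th term has valuation at
least `m`. -/
def formalSum (f : ℕ → ℕ → D) : ℕ → D := fun n => ∑ m ∈ range (n + 1), f m n

/-- A linear operator on `D[[λ]]` raising the `λ`-adic valuation. -/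
def RaisesValuation (T : Module.End k (ℕ → D)) : Prop :=
  ∀ m, ∀ x ∈ vanishBelow k D m, T x ∈ vanishBelow k D (m + 1)

/-- The action of a power series in an operator on `D[[λ]]`. -/
noncomputable def opSeries (F : PowerSeries k) (T : Module.End k (ℕ → D)) (x : ℕ → D) : ℕ → D :=
  formalSum fun m => PowerSeries.coeff m F • (T ^ m) x

/-- Convolution along `b` with a fixed series on the right. -/
def convRight (b : D →ₗ[k] D →ₗ[k] D) (w : ℕ → D) : Module.End k (ℕ → D) where
  toFun x := conv b x w
  map_add' x y := by ext n; simp [conv, sum_add_distrib]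
  map_smul' c x := by ext n; simp [conv, smul_sum]

/-- Convolution along `b` with a fixed series on the left. -/
def convLeft (b : D →ₗ[k] D →ₗ[k] D) (w : ℕ → D) : Module.End k (ℕ → D) where
  toFun x := conv b w x
  map_add' x y := by ext n; simp [conv, sum_add_distrib]
  map_smul' c x := by ext n; simp [conv, smul_sum]

theorem vanishBelow_anti {m n : ℕ} (h : m ≤ n) : vanishBelow k D n ≤ vanishBelow k D m :=
  fun _ hx i hi => hx i (hi.trans_le h)

theorem mem_vanishBelow_zero (x : ℕ → D) : x ∈ vanishBelow k D 0 :=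
  fun _ hi => absurd hi (Nat.not_lt_zero _)

theorem map_formalSum (T : Module.End k (ℕ → D))
    (hT : ∀ m, ∀ x ∈ vanishBelow k D m, T x ∈ vanishBelow k D m)
    (f : ℕ → ℕ → D) (hf : ∀ m, f m ∈ vanishBelow k D m) :
    T (formalSum f) = formalSum fun m => T (f m) := by
  ext n
  have hmem : formalSum f - ∑ m ∈ range (n + 1), f m ∈ vanishBelow k D (n + 1) := by
    intro i hi
    have hsub : range (i + 1) ⊆ range (n + 1) := range_subset_range.2 (by omega)
    simp only [formalSum, Pi.sub_apply, Finset.sum_apply]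
    rw [sum_subset hsub, sub_self]
    intro m _ hm
    exact hf m i (by simpa using hm)
  have h := hT _ _ hmem n (Nat.lt_succ_self n)
  rw [map_sub, map_sum, Pi.sub_apply, Finset.sum_apply, sub_eq_zero] at h
  exact h

theorem formalSum_formalSum (f : ℕ → ℕ → ℕ → D)
    (hf : ∀ i j, f i j ∈ vanishBelow k D (i + j)) :
    (formalSum fun i => formalSum (f i)) =
      formalSum fun n => ∑ ij ∈ antidiagonal n, f ij.1 ij.2 := by
  ext n
  simp only [formalSum, Finset.sum_apply]
  rw [← sum_product', sum_sigma']
  symm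
  refine sum_bij_ne_zero (fun x _ _ => x.2) ?_ ?_ ?_ ?_
  · rintro ⟨m, i, j⟩ h _
    simp only [mem_sigma, mem_range, HasAntidiagonal.mem_antidiagonal, mem_product] at h ⊢
    omega
  · rintro ⟨m, i, j⟩ h _ ⟨m', i', j'⟩ h' _ e
    simp only [mem_sigma, mem_range, HasAntidiagonal.mem_antidiagonal, Prod.mk.injEq] at h h' e
    obtain ⟨rfl, rfl⟩ := e
    obtain ⟨-, rfl⟩ := h
    obtain ⟨-, rfl⟩ := h'
    rfl
  · rintro ⟨i, j⟩ _ hne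
    refine ⟨⟨i + j, i, j⟩, ?_, hne, rfl⟩
    simp only [mem_sigma, mem_range, HasAntidiagonal.mem_antidiagonal, and_true]
    by_contra h
    exact hne (hf i j n (by omega))
  · intros
    rfl

theorem formalSum_eq_add (f : ℕ → ℕ → D) (hf : ∀ m, f m ∈ vanishBelow k D m) :
    formalSum f = f 0 + formalSum fun m => f (m + 1) := by
  ext n
  have h := sum_range_succ' (fun m => f m n) (n + 1)
  rw [sum_range_succ, hf (n + 1) n (Nat.lt_succ_self n), add_zero] at h
  simp only [formalSum, Pi.add_apply, h, add_comm]

namespace RaisesValuation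

variable {T U : Module.End k (ℕ → D)}

theorem sub (hT : RaisesValuation T) (hU : RaisesValuation U) : RaisesValuation (T - U) :=
  fun m x hx => sub_mem (hT m x hx) (hU m x hx)

theorem pow_mem (hT : RaisesValuation T) (m n : ℕ) {x : ℕ → D} (hx : x ∈ vanishBelow k D n) :
    (T ^ m) x ∈ vanishBelow k D (m + n) := by
  induction m with
  | zero => simpa using hx
  | succ m ih =>
    rw [pow_succ', Module.End.mul_apply, show m + 1 + n = m + n + 1 by omega]
    exact hT _ _ ih

theorem pow_mem' (hT : RaisesValuation T) (m : ℕ) (x : ℕ → D) :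
    (T ^ m) x ∈ vanishBelow k D m :=
  hT.pow_mem m 0 (mem_vanishBelow_zero x)

theorem map_formalSum (hT : RaisesValuation T) (m : ℕ)
    (f : ℕ → ℕ → D) (hf : ∀ m, f m ∈ vanishBelow k D m) :
    (T ^ m) (formalSum f) = formalSum fun n => (T ^ m) (f n) :=
  _root_.map_formalSum _
    (fun _ _ hx => vanishBelow_anti (Nat.le_add_left _ _) (hT.pow_mem m _ hx)) f hf

theorem opSeries_mul (hT : RaisesValuation T) (F G : PowerSeries k) (x : ℕ → D) :
    opSeries F T (opSeries G T x) = opSeries (F * G) T x := by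
  have hG (j : ℕ) : PowerSeries.coeff j G • (T ^ j) x ∈ vanishBelow k D j :=
    Submodule.smul_mem _ _ (hT.pow_mem' j x)
  have h (i : ℕ) : PowerSeries.coeff i F • (T ^ i) (opSeries G T x) =
      formalSum fun j => PowerSeries.coeff i F • (T ^ i) (PowerSeries.coeff j G • (T ^ j) x) := by
    rw [opSeries, hT.map_formalSum i _ hG]
    ext n
    simp [formalSum, smul_sum]
  rw [opSeries]
  simp only [h]
  rw [formalSum_formalSum (k := k)]
  · unfold opSeries
    congr 1
    ext1 n
    rw [PowerSeries.coeff_mul, sum_smul]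
    refine sum_congr rfl fun ij hij => ?_
    rw [map_smul, smul_smul, ← Module.End.mul_apply, ← pow_add, HasAntidiagonal.mem_antidiagonal.1 hij]
  · exact fun i j => Submodule.smul_mem _ _ (hT.pow_mem i j (hG j))

end RaisesValuation

theorem opSeries_one (T : Module.End k (ℕ → D)) (x : ℕ → D) : opSeries 1 T x = x := by
  ext n
  simp [opSeries, formalSum, PowerSeries.coeff_one]

theorem convRight_raisesValuation (b : D →ₗ[k] D →ₗ[k] D) {w : ℕ → D} (hw : w 0 = 0) :
    RaisesValuation (convRight b w) := by
  intro m x hx n hn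
  change ∑ ij ∈ antidiagonal n, b (x ij.1) (w ij.2) = 0
  refine Finset.sum_eq_zero fun ij hij => ?_
  rw [HasAntidiagonal.mem_antidiagonal] at hij
  rcases Nat.eq_zero_or_pos ij.2 with h | h
  · rw [h, hw, map_zero]
  · rw [hx ij.1 (by omega), map_zero, LinearMap.zero_apply]

theorem convLeft_mem_vanishBelow (b : D →ₗ[k] D →ₗ[k] D) (w : ℕ → D) (m : ℕ)
    (x : ℕ → D) (hx : x ∈ vanishBelow k D m) : convLeft b w x ∈ vanishBelow k D m := by
  intro n hn
  change ∑ ij ∈ antidiagonal n, b (w ij.1) (x ij.2) = 0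
  refine Finset.sum_eq_zero fun ij hij => ?_
  rw [HasAntidiagonal.mem_antidiagonal] at hij
  rw [hx ij.2 (by omega), map_zero]

theorem convLeft_raisesValuation (b : D →ₗ[k] D →ₗ[k] D) {w : ℕ → D} (hw : w 0 = 0) :
    RaisesValuation (convLeft b w) := by
  intro m x hx n hn
  change ∑ ij ∈ antidiagonal n, b (w ij.1) (x ij.2) = 0
  refine Finset.sum_eq_zero fun ij hij => ?_
  rw [HasAntidiagonal.mem_antidiagonal] at hij
  rcases Nat.eq_zero_or_pos ij.1 with h | h
  · rw [h, hw, map_zero, LinearMap.zero_apply]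
  · rw [hx ij.2 (by omega), map_zero]

/-- An associativity relation between bilinear operations extends to convolutions. -/
theorem conv_assoc (b c e f : D →ₗ[k] D →ₗ[k] D)
    (h : ∀ x y z, b (c x y) z = e x (f y z)) (x y z : ℕ → D) :
    conv b (conv c x y) z = conv e x (conv f y z) := by
  ext n
  simp only [conv, map_sum, LinearMap.sum_apply, h]
  rw [sum_sigma', sum_sigma']
  refine sum_nbij' (fun t => ⟨(t.2.1, t.2.2 + t.1.2), (t.2.2, t.1.2)⟩)
    (fun t => ⟨(t.1.1 + t.2.1, t.2.2), (t.1.1, t.2.1)⟩) ?_ ?_ ?_ ?_ ?_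
  all_goals rintro ⟨⟨i, j⟩, ⟨i', j'⟩⟩ ht
  all_goals simp only [mem_sigma, HasAntidiagonal.mem_antidiagonal] at ht ⊢
  all_goals obtain ⟨rfl, h'⟩ := ht
  · exact ⟨by omega, trivial⟩
  · exact ⟨by omega, trivial⟩
  · subst h'; rfl
  · subst h'; rfl

/-- The power series `(exp X - 1) / X`. -/
noncomputable def expQuot (k : Type) [Field k] : PowerSeries k :=
  PowerSeries.mk fun n => ((n + 1).factorial : k)⁻¹

theorem bernoulliPowerSeries_mul_expQuot [CharZero k] :
    bernoulliPowerSeries k * expQuot k = 1 := by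
  have h : PowerSeries.exp k - 1 = expQuot k * PowerSeries.X := by
    ext n
    cases n with
    | zero => simp
    | succ n =>
      simp [expQuot, PowerSeries.coeff_succ_mul_X, PowerSeries.coeff_one, PowerSeries.coeff_exp]
  have hb := bernoulliPowerSeries_mul_exp_sub_one k
  rw [h, ← mul_assoc] at hb
  exact mul_right_cancel₀ PowerSeries.X_ne_zero (hb.trans (one_mul _).symm)

/-- The operator `(exp T - 1) / T` is inverted by the Bernoulli series of `T`. -/
theorem RaisesValuation.bernoulli_expQuot [CharZero k] {T : Module.End k (ℕ → D)}
    (hT : RaisesValuation T) (x : ℕ → D) :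
    opSeries (bernoulliPowerSeries k) T (opSeries (expQuot k) T x) = x := by
  rw [hT.opSeries_mul, bernoulliPowerSeries_mul_expQuot, opSeries_one]

theorem RaisesValuation.opSeries_exp_injective [CharZero k] {T : Module.End k (ℕ → D)}
    (hT : RaisesValuation T) : Function.Injective (opSeries (PowerSeries.exp k) T) := by
  intro x y h
  have h' := congrArg (opSeries (PowerSeries.evalNegHom (PowerSeries.exp k)) T) h
  rwa [hT.opSeries_mul, hT.opSeries_mul, mul_comm, PowerSeries.exp_mul_exp_neg_eq_one,
    opSeries_one, opSeries_one] at h'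

/-- `∑ (r + d)^i r^j w` over `i + j = n`, expanded in the commuting operators `r` and `d`. -/
theorem geom_sum_expand {M : Type*} [AddCommGroup M] [Module k M] {r d : Module.End k M}
    (h : Commute r d) (w : M) (g : ℕ → M) (h0 : g 0 = w)
    (hs : ∀ n, g (n + 1) = r (g n) + ((r + d) ^ (n + 1)) w) (n : ℕ) :
    g n = ∑ ij ∈ antidiagonal n, (n + 1).choose ij.1 • (r ^ ij.1) ((d ^ ij.2) w) := by
  induction n with
  | zero => simp [h0]
  | succ n ih =>
    rw [hs, ih, h.add_pow', Nat.sum_antidiagonal_succ, Nat.sum_antidiagonal_succ,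
      LinearMap.add_apply, LinearMap.sum_apply, map_sum, add_left_comm, ← sum_add_distrib]
    refine congrArg₂ (· + ·) (by simp) (sum_congr rfl fun ij _ => ?_)
    rw [Nat.choose_succ_succ (n + 1), add_smul, map_nsmul, pow_succ' r]
    rfl

theorem conv_add (b c : D →ₗ[k] D →ₗ[k] D) (x y : ℕ → D) :
    conv (b + c) x y = conv b x y + conv c x y := by
  ext n
  simp [conv, sum_add_distrib]

theorem inv_factorial_mul_choose [CharZero k] {i j n : ℕ} (h : i + j = n) :
    ((n + 1).factorial : k)⁻¹ * ((n + 1).choose i : k) =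
      ((i.factorial : k)⁻¹) * ((j + 1).factorial : k)⁻¹ := by
  have hc := Nat.choose_mul_factorial_mul_factorial (show i ≤ n + 1 by omega)
  rw [show n + 1 - i = j + 1 by omega] at hc
  have hc' : ((n + 1).choose i : k) * (i.factorial : k) * ((j + 1).factorial : k) =
      ((n + 1).factorial : k) := by exact_mod_cast hc
  have h1 : (i.factorial : k) ≠ 0 := Nat.cast_ne_zero.2 i.factorial_ne_zero
  have h2 : ((j + 1).factorial : k) ≠ 0 := Nat.cast_ne_zero.2 (j + 1).factorial_ne_zero
  have h3 : ((n + 1).factorial : k) ≠ 0 := Nat.cast_ne_zero.2 (n + 1).factorial_ne_zero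
  field_simp
  linear_combination hc'

variable {p s : D →ₗ[k] D →ₗ[k] D}

theorem commute_convRight_convLeft (ax2 : ∀ a b c : D, p (s a b) c = s a (p b c)) (w : ℕ → D) :
    Commute (convRight p w) (convLeft s w) :=
  LinearMap.ext fun x => conv_assoc p s s p ax2 w x w

theorem conv_prec_pow (ax1 : ∀ a b c : D, p (p a b) c = p a (p b c + s b c))
    (w y : ℕ → D) (n : ℕ) :
    convLeft p y ((convRight (p + s) w ^ n) w) = (convRight p w ^ (n + 1)) y := by
  induction n with
  | zero => simp [convLeft, convRight]
  | succ n ih =>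
    rw [pow_succ', pow_succ' _ (n + 1), Module.End.mul_apply, Module.End.mul_apply, ← ih]
    exact (conv_assoc p p p (p + s) ax1 y _ w).symm

theorem conv_succ_pow (ax3 : ∀ a b c : D, s a (s b c) = s (p a b + s a b) c)
    (w z : ℕ → D) (n : ℕ) :
    conv s ((convRight (p + s) w ^ n) w) z = (convLeft s w ^ (n + 1)) z := by
  induction n generalizing z with
  | zero => simp [convLeft]
  | succ n ih =>
    rw [pow_succ', pow_succ _ (n + 1), Module.End.mul_apply, Module.End.mul_apply, ← ih]
    exact conv_assoc s (p + s) s s (fun a b c => (ax3 a b c).symm) _ w z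

theorem star_pow_expand (ax2 : ∀ a b c : D, p (s a b) c = s a (p b c))
    (ax3 : ∀ a b c : D, s a (s b c) = s (p a b + s a b) c) (w : ℕ → D) (n : ℕ) :
    (convRight (p + s) w ^ n) w = ∑ ij ∈ antidiagonal n, (n + 1).choose ij.1 •
      (convRight p w ^ ij.1) (((convLeft s w - convRight p w) ^ ij.2) w) := by
  refine geom_sum_expand (k := k)
    ((commute_convRight_convLeft ax2 w).sub_right (Commute.refl _)) w
    (fun n => (convRight (p + s) w ^ n) w) (by simp) (fun n => ?_) n
  rw [add_sub_cancel, ← conv_succ_pow ax3, pow_succ', Module.End.mul_apply]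
  exact conv_add p s _ w

/-- `exp*(Ω) - 1 = e^{R_≺[Ω]} ((e^{L_▷[Ω]} - 1) / L_▷[Ω]) (Ω)`. -/
theorem expQuot_star [CharZero k] (ax2 : ∀ a b c : D, p (s a b) c = s a (p b c))
    (ax3 : ∀ a b c : D, s a (s b c) = s (p a b + s a b) c) {w : ℕ → D} (hw : w 0 = 0) :
    opSeries (expQuot k) (convRight (p + s) w) w =
      opSeries (PowerSeries.exp k) (convRight p w)
        (opSeries (expQuot k) (convLeft s w - convRight p w) w) := by
  have hr := convRight_raisesValuation p hw
  have hd := (convLeft_raisesValuation s hw).sub hr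
  have hE (j : ℕ) : PowerSeries.coeff j (expQuot k) •
      ((convLeft s w - convRight p w) ^ j) w ∈ vanishBelow k D j :=
    Submodule.smul_mem _ _ (hd.pow_mem' j w)
  have h (i : ℕ) : PowerSeries.coeff i (PowerSeries.exp k) • (convRight p w ^ i)
        (opSeries (expQuot k) (convLeft s w - convRight p w) w) =
      formalSum fun j => PowerSeries.coeff i (PowerSeries.exp k) • (convRight p w ^ i)
        (PowerSeries.coeff j (expQuot k) • ((convLeft s w - convRight p w) ^ j) w) := by
    rw [opSeries, hr.map_formalSum i _ hE]
    ext n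
    simp [formalSum, smul_sum]
  rw [opSeries, opSeries]
  simp only [h]
  rw [formalSum_formalSum (k := k)]
  · congr 1
    ext1 n
    rw [star_pow_expand ax2 ax3, smul_sum]
    refine sum_congr rfl fun ij hij => ?_
    rw [map_smul, smul_smul, ← Nat.cast_smul_eq_nsmul k, smul_smul]
    congr 1
    simpa [expQuot, PowerSeries.coeff_exp] using
      inv_factorial_mul_choose (k := k) (HasAntidiagonal.mem_antidiagonal.1 hij)
  · exact fun i j => Submodule.smul_mem _ _ (hr.pow_mem i j (hE j))

/-- The solution of `Z = y + y ≺ Z` of the form `Z = exp*(w) - 1` satisfies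
`((e^{L_▷[w]} - 1) / L_▷[w]) (w) = y`. -/
theorem expQuot_preLie [CharZero k] (ax1 : ∀ a b c : D, p (p a b) c = p a (p b c + s b c))
    (ax2 : ∀ a b c : D, p (s a b) c = s a (p b c))
    (ax3 : ∀ a b c : D, s a (s b c) = s (p a b + s a b) c) {w y : ℕ → D} (hw : w 0 = 0)
    (h : opSeries (expQuot k) (convRight (p + s) w) w =
      y + conv p y (opSeries (expQuot k) (convRight (p + s) w) w)) :
    opSeries (expQuot k) (convLeft s w - convRight p w) w = y := by
  have hr := convRight_raisesValuation p hw
  have hT := convRight_raisesValuation (p + s) hw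
  apply hr.opSeries_exp_injective
  rw [← expQuot_star ax2 ax3 hw, h]
  change y + convLeft p y (opSeries (expQuot k) (convRight (p + s) w) w) = _
  rw [opSeries, opSeries, map_formalSum _ (convLeft_mem_vanishBelow p y) _
      (fun m => Submodule.smul_mem _ _ (hT.pow_mem' m w)),
    formalSum_eq_add (k := k) _ (fun m => Submodule.smul_mem _ _ (hr.pow_mem' m y))]
  congr 1
  · simp
  · congr 1
    ext1 m
    rw [map_smul, conv_prec_pow ax1]
    simp [expQuot, PowerSeries.coeff_exp]

theorem sconv_zero_left (f : ℕ → D) : sconv (0 : ℕ → k) f = 0 := by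
  ext n
  simp [sconv]

theorem sconv_augOne (f : ℕ → D) : sconv (augOne : Aug k D).1 f = f := by
  ext n
  rw [sconv, sum_eq_single (0, n)]
  · simp [augOne]
  · rintro ⟨i, j⟩ hij hne
    rw [HasAntidiagonal.mem_antidiagonal] at hij
    have hi : i ≠ 0 := fun hi => hne (by simp_all)
    simp [augOne, hi]
  · simp

theorem starPow_fst (Ω : Aug k D) (n : ℕ) :
    (starPow p s Ω n).1 = (convRight (LinearMap.mul k k) Ω.1 ^ n) (augOne : Aug k D).1 := by
  induction n with
  | zero => rfl
  | succ n ih =>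
    rw [pow_succ', Module.End.mul_apply, ← ih]
    rfl

theorem convRight_mul_augOne (t : ℕ → k) :
    convRight (LinearMap.mul k k) t (augOne : Aug k D).1 = t := by
  refine Eq.trans ?_ (sconv_augOne (k := k) (D := k) t)
  ext n
  simp [convRight, conv, sconv, augOne]

/-- The scalar part of a logarithm of a series with scalar part `1` vanishes. -/
theorem fst_eq_zero_of_expStar [CharZero k] {Ω : Aug k D} (h0 : Ω.1 0 = 0)
    (h : (expStar p s Ω).1 = (augOne : Aug k D).1) : Ω.1 = 0 := by
  have hT := convRight_raisesValuation (LinearMap.mul k k) h0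
  have hexp : (expStar p s Ω).1 = formalSum fun m => ((m.factorial : k))⁻¹ •
      (convRight (LinearMap.mul k k) Ω.1 ^ m) (augOne : Aug k D).1 := by
    simp only [← starPow_fst (p := p) (s := s)]
    rfl
  rw [hexp, formalSum_eq_add (k := k) _ (fun m => Submodule.smul_mem _ _ (hT.pow_mem' m _))] at h
  simp only [pow_succ, Module.End.mul_apply, convRight_mul_augOne] at h
  have hE : opSeries (expQuot k) (convRight (LinearMap.mul k k) Ω.1) Ω.1 = 0 := by
    simpa [opSeries, expQuot] using h
  rw [← hT.bernoulli_expQuot Ω.1, hE]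
  ext n
  simp [opSeries, formalSum]

theorem starPow_snd {w : ℕ → D} (n : ℕ) :
    starPow p s ((0, w) : Aug k D) (n + 1) = (0, (convRight (p + s) w ^ n) w) := by
  induction n with
  | zero =>
    refine Prod.ext ?_ ?_
    · ext n
      simp [starPow, starA, kconv]
    · change conv p 0 w + conv s 0 w + sconv 0 0 + sconv (augOne : Aug k D).1 w = w
      rw [sconv_augOne, sconv_zero_left]
      ext n
      simp [conv]
  | succ n ih =>
    rw [starPow, ih]
    refine Prod.ext ?_ ?_
    · ext n
      simp [starA, kconv]
    · rw [pow_succ', Module.End.mul_apply]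
      simp only [starA, sconv_zero_left, add_zero]
      exact (conv_add p s _ w).symm

theorem expStar_snd {w : ℕ → D} (hw : w 0 = 0) :
    (expStar p s ((0, w) : Aug k D)).2 = opSeries (expQuot k) (convRight (p + s) w) w := by
  have hT := convRight_raisesValuation (p + s) hw
  have hw1 : w ∈ vanishBelow k D 1 := fun i hi => by
    rw [Nat.lt_one_iff.1 hi, hw]
  change formalSum (fun m => ((m.factorial : k))⁻¹ • (starPow p s ((0, w) : Aug k D) m).2) = _
  rw [formalSum_eq_add (k := k)]
  · simp only [starPow_snd]
    simp [starPow, augOne, opSeries, expQuot]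
  · rintro (_ | m)
    · exact mem_vanishBelow_zero _
    · rw [starPow_snd]
      exact Submodule.smul_mem _ _ (hT.pow_mem m 1 hw1)

theorem lam_precA_snd (x z : Aug k D) :
    (lam (precA p x z)).2 = conv p (lam x).2 z.2 + sconv z.1 (lam x).2 := by
  ext n
  cases n with
  | zero => simp [lam, conv, sconv]
  | succ n =>
    simp only [conv, sconv, Pi.add_apply]
    rw [Nat.sum_antidiagonal_succ, Nat.sum_antidiagonal_succ']
    simp [lam, precA, conv, sconv]

theorem iterL_eq (w y : ℕ → D) (m : ℕ) :
    iterL p s ((0, w) : Aug k D) m (0, y) =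
      (0, ((convLeft s w - convRight p w) ^ m) y) := by
  induction m with
  | zero => rfl
  | succ m ih =>
    rw [iterL, ih, pow_succ', Module.End.mul_apply]
    simp only [preLieL, succA, precA, sconv_zero_left, add_zero]
    exact Prod.ext (sub_zero _) rfl

theorem iterR_eq (w y : ℕ → D) (m : ℕ) :
    iterR p s ((0, w) : Aug k D) m (0, y) =
      (0, (-1 : k) ^ m • ((convLeft s w - convRight p w) ^ m) y) := by
  induction m with
  | zero => simp [iterR]
  | succ m ih =>
    rw [iterR, ih, pow_succ' (-1 : k), neg_one_mul, neg_smul, pow_succ' (_ - _),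
      Module.End.mul_apply, ← map_smul (convLeft s w - convRight p w),
      LinearMap.sub_apply, neg_sub]
    simp only [preLieR, succA, precA, sconv_zero_left, add_zero]
    exact Prod.ext (sub_zero _) rfl

end DendriformSeries

section DendriformAug

variable {k : Type} [Field k] [CharZero k]
variable {D : Type} [AddCommGroup D] [Module k D]
variable (p s : D →ₗ[k] D →ₗ[k] D)

/-- Pre-Lie Magnus expansion.  Let `Ā` be a unital dendriform algebra, `a ∈ A`, and
`Y ∈ Ā[[λ]]` the solution of `Y = 1 + λ a ≺ Y`, whose inverse solves
`Y⁻¹ = 1 − λ Y⁻¹ ≻ a`.  Let `Ω' ∈ λ Ā[[λ]]` be such that `Y = exp*(Ω')` and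
`Y⁻¹ = exp*(−Ω')`.  Then
`Ω' = Σ_{m≥0} (−1)^m (B_m/m!) R_◁[Ω']^{(m)}(λa)` and
`Ω' = Σ_{m≥0} (B_m/m!) L_▷[Ω']^{(m)}(λa)`, where `B_m` are the Bernoulli numbers
(with `B₁ = −1/2`). -/
theorem preLie_magnus_expansion
    (ax1 : ∀ a b c : D, p (p a b) c = p a (p b c + s b c))
    (ax2 : ∀ a b c : D, p (s a b) c = s a (p b c))
    (ax3 : ∀ a b c : D, s a (s b c) = s (p a b + s a b) c)
    (a : D) (Y Yi Ω : Aug k D)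
    (hΩ : Ω.1 0 = 0 ∧ Ω.2 0 = 0)
    (hY : Y = augOne + lam (precA p (ofD a) Y))
    (hYi : Yi = augOne - lam (succA s Yi (ofD a)))
    (hYexp : Y = expStar p s Ω)
    (hYiexp : Yi = expStar p s (-Ω)) :
    Ω = seriesSum (fun m =>
        ((-1) ^ m * ((bernoulli m : ℚ) : k) / (Nat.factorial m : k)) •
          iterR p s Ω m (lam (ofD a))) ∧
    Ω = seriesSum (fun m =>
        (((bernoulli m : ℚ) : k) / (Nat.factorial m : k)) •
          iterL p s Ω m (lam (ofD a))) := by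
  have hY1 : Y.1 = (augOne : Aug k D).1 := by
    rw [hY]
    ext n
    cases n <;> simp [lam, precA]
  have hΩ1 : Ω.1 = 0 := fst_eq_zero_of_expStar hΩ.1 (by rw [← hYexp, hY1])
  obtain ⟨t, w⟩ := Ω
  obtain rfl : t = 0 := hΩ1
  have hw : w 0 = 0 := hΩ.2
  have hY2 : Y.2 = opSeries (expQuot k) (convRight (p + s) w) w := by
    rw [hYexp, expStar_snd hw]
  have hrec : Y.2 = (lam (ofD a : Aug k D)).2 + conv p (lam (ofD a : Aug k D)).2 Y.2 := by
    conv_lhs => rw [hY]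
    rw [Prod.snd_add, lam_precA_snd, hY1, sconv_augOne, add_comm (conv _ _ _)]
    exact zero_add _
  rw [hY2] at hrec
  have hy := expQuot_preLie ax1 ax2 ax3 hw hrec
  have hd := (convLeft_raisesValuation s hw).sub (convRight_raisesValuation p hw)
  have hlam : lam (ofD a : Aug k D) = (0, (lam (ofD a : Aug k D)).2) := by
    refine Prod.ext ?_ rfl
    ext n
    cases n <;> rfl
  have hL : ((0, w) : Aug k D) = seriesSum (fun m =>
      (((bernoulli m : ℚ) : k) / (Nat.factorial m : k)) •
        iterL p s (0, w) m (lam (ofD a))) := by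
    rw [hlam]
    simp only [iterL_eq]
    refine Prod.ext ?_ ?_
    · ext n
      simp [seriesSum]
    · refine (hd.bernoulli_expQuot w).symm.trans ?_
      rw [hy]
      ext n
      simp [opSeries, formalSum, seriesSum, bernoulliPowerSeries]
  refine ⟨?_, hL⟩
  rw [hlam] at hL ⊢
  simp only [iterL_eq] at hL
  simp only [iterR_eq]
  refine hL.trans (congrArg _ (funext fun m => ?_))
  refine Prod.ext (by simp) ?_
  change _ • _ = _ • _ • _
  rw [smul_smul, mul_div_assoc, mul_right_comm, ← mul_pow, neg_one_mul, neg_neg, one_pow,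
    one_mul]

end DendriformAug
end
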